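/- Let G = (V,E) be a graph and let V = H_1 ∪ … ∪ H_k be a partition of V into disjoint subsets. For each i, let ρ_i be a density matrix (a positive semidefinite matrix of trace 1) on (ℂ²)^{⊗H_i}. Then there exists a density matrix ρ' on (ℂ²)^{⊗V} such that tr(Q_{uv} ρ') = tr(Q_{uv} ρ_i) for every edge uv ∈ E with both endpoints in the same block H_i, and tr(Q_{uv} ρ') = 1/4 for every edge uv ∈ E whose endpoints lie in two distinct blocks. -/

import Mathlib

open scoped ComplexOrder

/-- The Pauli `X` matrix. -/
noncomputable def PauliX : Matrix (Fin 2) (Fin 2) ℂ := !![0, 1; 1, 0]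

/-- The Pauli `Y` matrix. -/
noncomputable def PauliY : Matrix (Fin 2) (Fin 2) ℂ := !![0, -Complex.I; Complex.I, 0]

/-- The Pauli `Z` matrix. -/
noncomputable def PauliZ : Matrix (Fin 2) (Fin 2) ℂ := !![1, 0; 0, -1]

/-- The one-qubit operator `σ` acting on the tensor factor of vertex `u` in
`(ℂ²)^{⊗V}`, realized as a matrix indexed by computational basis states `V → Fin 2`. -/
noncomputable def onQubit {V : Type*} [Fintype V] [DecidableEq V]
    (σ : Matrix (Fin 2) (Fin 2) ℂ) (u : V) :
    Matrix (V → Fin 2) (V → Fin 2) ℂ :=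
  Matrix.of fun s t => if ∀ v, v ≠ u → s v = t v then σ (s u) (t u) else 0

/-- The Quantum Max-Cut edge term `Q_{uv} = (I − X_u X_v − Y_u Y_v − Z_u Z_v)/4`. -/
noncomputable def qmcTerm {V : Type*} [Fintype V] [DecidableEq V] (u v : V) :
    Matrix (V → Fin 2) (V → Fin 2) ℂ :=
  (1 / 4 : ℂ) •
    ((1 : Matrix (V → Fin 2) (V → Fin 2) ℂ)
      - onQubit PauliX u * onQubit PauliX v
      - onQubit PauliY u * onQubit PauliY v
      - onQubit PauliZ u * onQubit PauliZ v)

/-- The Quantum Max-Cut Hamiltonian `Q = Σ_{uv ∈ E} w_{uv} Q_{uv}` of a weighted graph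
(each unordered edge appears twice in the double sum, hence the factor `1/2`). -/
noncomputable def qmcHamiltonian {V : Type*} [Fintype V] [DecidableEq V]
    (G : SimpleGraph V) [DecidableRel G.Adj] (w : V → V → ℝ) :
    Matrix (V → Fin 2) (V → Fin 2) ℂ :=
  (1 / 2 : ℂ) • ∑ u : V, ∑ v : V, if G.Adj u v then (w u v : ℂ) • qmcTerm u v else 0

/-- The total edge weight `m = Σ_{uv ∈ E} w_{uv}` of a weighted graph (each unordered
edge appears twice in the double sum, hence the factor `1/2`). -/
noncomputable def totalWeight {V : Type*} [Fintype V] [DecidableEq V]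
    (G : SimpleGraph V) [DecidableRel G.Adj] (w : V → V → ℝ) : ℝ :=
  (1 / 2 : ℝ) * ∑ u : V, ∑ v : V, if G.Adj u v then w u v else 0

/-- `W = Σ_{u : N(u) ≠ ∅} max_{v ∈ N(u)} w_{uv}`: the sum over non-isolated vertices of
the largest weight of an incident edge. -/
noncomputable def maxIncidentWeight {V : Type*} [Fintype V] [DecidableEq V]
    (G : SimpleGraph V) [DecidableRel G.Adj] (w : V → V → ℝ) : ℝ :=
  ∑ u : V,
    if h : (G.neighborFinset u).Nonempty then (G.neighborFinset u).sup' h (w u) else 0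

open Matrix

section PiKronecker

variable {ι : Type*} [Fintype ι] [DecidableEq ι] {n : ι → Type*}
  [∀ i, Fintype (n i)] [∀ i, DecidableEq (n i)]

/-- The tensor product of a finite family of square matrices. -/
def piKronecker (A : ∀ i, Matrix (n i) (n i) ℂ) : Matrix (∀ i, n i) (∀ i, n i) ℂ :=
  Matrix.of fun s t => ∏ i, A i (s i) (t i)

omit [DecidableEq ι] [∀ i, Fintype (n i)] [∀ i, DecidableEq (n i)] in
theorem piKronecker_apply (A : ∀ i, Matrix (n i) (n i) ℂ) (s t : ∀ i, n i) :
    piKronecker A s t = ∏ i, A i (s i) (t i) := rfl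

omit [∀ i, DecidableEq (n i)] in
theorem piKronecker_mul (A B : ∀ i, Matrix (n i) (n i) ℂ) :
    piKronecker A * piKronecker B = piKronecker fun i => A i * B i := by
  ext s t
  simp only [mul_apply, piKronecker_apply, Finset.prod_univ_sum, Fintype.piFinset_univ,
    Finset.prod_mul_distrib]

omit [DecidableEq ι] [∀ i, Fintype (n i)] [∀ i, DecidableEq (n i)] in
theorem piKronecker_conjTranspose (A : ∀ i, Matrix (n i) (n i) ℂ) :
    (piKronecker A)ᴴ = piKronecker fun i => (A i)ᴴ := by
  ext s t
  simp [piKronecker_apply]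

omit [∀ i, DecidableEq (n i)] in
theorem trace_piKronecker (A : ∀ i, Matrix (n i) (n i) ℂ) :
    (piKronecker A).trace = ∏ i, (A i).trace := by
  simp only [trace, diag_apply, piKronecker_apply, Finset.prod_univ_sum, Fintype.piFinset_univ]

omit [∀ i, Fintype (n i)] in
theorem piKronecker_mulSingle_apply (i : ι) (M : Matrix (n i) (n i) ℂ) (s t : ∀ i, n i) :
    piKronecker (Pi.mulSingle i M) s t =
      if ∀ j, j ≠ i → s j = t j then M (s i) (t i) else 0 := by
  rw [piKronecker_apply]
  split_ifs with h
  · rw [Finset.prod_eq_single i]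
    · simp
    · intro j _ hj
      simp [Pi.mulSingle_eq_of_ne hj, h j hj]
    · simp
  · push Not at h
    obtain ⟨j, hj, hst⟩ := h
    refine Finset.prod_eq_zero (Finset.mem_univ j) ?_
    simp [Pi.mulSingle_eq_of_ne hj, hst]

omit [DecidableEq ι] [∀ i, Fintype (n i)] in
theorem piKronecker_one :
    piKronecker (fun i => (1 : Matrix (n i) (n i) ℂ)) = 1 := by
  ext s t
  rw [piKronecker_apply, one_apply]
  split_ifs with h
  · subst h
    exact Finset.prod_eq_one fun i _ => one_apply_eq _
  · obtain ⟨j, hj⟩ := Function.ne_iff.mp h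
    exact Finset.prod_eq_zero (Finset.mem_univ j) (one_apply_ne hj)

open scoped MatrixOrder in
theorem posSemidef_piKronecker {A : ∀ i, Matrix (n i) (n i) ℂ} (hA : ∀ i, (A i).PosSemidef) :
    (piKronecker A).PosSemidef := by
  choose B hB using fun i => CStarAlgebra.nonneg_iff_eq_star_mul_self.mp (hA i).nonneg
  simp only [star_eq_conjTranspose] at hB
  rw [funext hB, ← piKronecker_mul, ← piKronecker_conjTranspose]
  exact posSemidef_conjTranspose_mul_self _

theorem piKronecker_mulSingle_mul (i : ι) (M N : Matrix (n i) (n i) ℂ) :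
    piKronecker (Pi.mulSingle i M) * piKronecker (Pi.mulSingle i N) =
      piKronecker (Pi.mulSingle i (M * N)) := by
  rw [piKronecker_mul, Pi.mulSingle_mul]
  rfl

theorem trace_piKronecker_mulSingle_mul {A : ∀ i, Matrix (n i) (n i) ℂ}
    (hA : ∀ i, (A i).trace = 1) (i : ι) (M : Matrix (n i) (n i) ℂ) :
    (piKronecker (Pi.mulSingle i M) * piKronecker A).trace = (M * A i).trace := by
  rw [piKronecker_mul, trace_piKronecker, Finset.prod_eq_single i]
  · simp
  · intro j _ hj
    simp [Pi.mulSingle_eq_of_ne hj, hA]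
  · simp

theorem trace_piKronecker_mulSingle_mul_mulSingle_mul {A : ∀ i, Matrix (n i) (n i) ℂ}
    {i j : ι} (hij : i ≠ j) {M : Matrix (n i) (n i) ℂ} (hM : (M * A i).trace = 0)
    (N : Matrix (n j) (n j) ℂ) :
    (piKronecker (Pi.mulSingle i M) * piKronecker (Pi.mulSingle j N) * piKronecker A).trace
      = 0 := by
  rw [piKronecker_mul, piKronecker_mul, trace_piKronecker]
  exact Finset.prod_eq_zero (Finset.mem_univ i) (by simp [Pi.mulSingle_eq_of_ne hij, hM])

end PiKronecker

section Twirl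

variable {V : Type*} [Fintype V] [DecidableEq V]

theorem onQubit_eq_piKronecker (σ : Matrix (Fin 2) (Fin 2) ℂ) (u : V) :
    onQubit σ u = piKronecker (n := fun _ => Fin 2) (Pi.mulSingle u σ) := by
  ext s t
  rw [piKronecker_mulSingle_apply]
  rfl

theorem onQubit_smul (c : ℂ) (σ : Matrix (Fin 2) (Fin 2) ℂ) (u : V) :
    onQubit (c • σ) u = c • onQubit σ u := by
  ext s t
  simp [onQubit]

/-- If `τσ = cστ`, then `τ^{⊗V} σ_u = c σ_u τ^{⊗V}`. -/
theorem piKronecker_const_mul_onQubit {τ σ : Matrix (Fin 2) (Fin 2) ℂ} {c : ℂ}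
    (h : τ * σ = c • (σ * τ)) (u : V) :
    piKronecker (fun _ : V => τ) * onQubit σ u =
      c • (onQubit σ u * piKronecker (fun _ : V => τ)) := by
  rw [← smul_mul_assoc, ← onQubit_smul, onQubit_eq_piKronecker, onQubit_eq_piKronecker,
    piKronecker_mul, piKronecker_mul]
  congr 1
  funext v
  by_cases hv : v = u
  · subst hv
    simp [h]
  · simp [Pi.mulSingle_eq_of_ne hv]

/-- The average of a matrix and its conjugate by `U`. -/
noncomputable def conjAverage {m : Type*} [Fintype m] (U ρ : Matrix m m ℂ) : Matrix m m ℂ :=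
  (1 / 2 : ℂ) • (ρ + U * ρ * Uᴴ)

theorem posSemidef_conjAverage {m : Type*} [Fintype m] (U : Matrix m m ℂ) {ρ : Matrix m m ℂ}
    (hρ : ρ.PosSemidef) : (conjAverage U ρ).PosSemidef :=
  (hρ.add (hρ.mul_mul_conjTranspose_same U)).smul (by norm_num [Complex.le_def])

theorem trace_mul_conjAverage {m : Type*} [Fintype m] [DecidableEq m] {U A : Matrix m m ℂ}
    {c : ℂ} (hU : Uᴴ * U = 1) (h : U * A = c • (A * U)) (hc : c * c = 1) (ρ : Matrix m m ℂ) :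
    (A * conjAverage U ρ).trace = (1 + c) / 2 * (A * ρ).trace := by
  have hA : A * U = c • (U * A) := by rw [h, smul_smul, hc, one_smul]
  have key : (A * (U * ρ * Uᴴ)).trace = c * (A * ρ).trace := by
    rw [← Matrix.mul_assoc, ← Matrix.mul_assoc, hA, trace_mul_comm, smul_mul_assoc,
      mul_smul_comm, trace_smul, Matrix.mul_assoc, ← Matrix.mul_assoc, hU,
      Matrix.one_mul, smul_eq_mul]
  rw [conjAverage, mul_smul_comm, trace_smul, Matrix.mul_add, trace_add, key, smul_eq_mul]
  ring

theorem pauliX_conjTranspose_mul_self : PauliXᴴ * PauliX = 1 := by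
  ext i j
  fin_cases i <;> fin_cases j <;> simp [PauliX, mul_apply]

theorem pauliZ_conjTranspose_mul_self : PauliZᴴ * PauliZ = 1 := by
  ext i j
  fin_cases i <;> fin_cases j <;> simp [PauliZ, mul_apply]

/-- Averaging a density matrix over the global Pauli group keeps every two-site correlation
of equal Pauli matrices and kills every one-site Pauli expectation. -/
theorem exists_pauli_twirl {ρ : Matrix (V → Fin 2) (V → Fin 2) ℂ} (hρ : ρ.PosSemidef)
    (htr : ρ.trace = 1) :
    ∃ ρ' : Matrix (V → Fin 2) (V → Fin 2) ℂ, ρ'.PosSemidef ∧ ρ'.trace = 1 ∧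
      ∀ σ, σ = PauliX ∨ σ = PauliY ∨ σ = PauliZ →
        (∀ u, (onQubit σ u * ρ').trace = 0) ∧
        ∀ u v, (onQubit σ u * onQubit σ v * ρ').trace
          = (onQubit σ u * onQubit σ v * ρ).trace := by
  have isometry {τ : Matrix (Fin 2) (Fin 2) ℂ} (h : τᴴ * τ = 1) :
      (piKronecker fun _ : V => τ)ᴴ * piKronecker (fun _ : V => τ) = 1 := by
    rw [piKronecker_conjTranspose, piKronecker_mul, h, piKronecker_one]
  have hX := isometry pauliX_conjTranspose_mul_self
  have hZ := isometry pauliZ_conjTranspose_mul_self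
  have signs (σ) (hσ : σ = PauliX ∨ σ = PauliY ∨ σ = PauliZ) :
      ∃ a b : ℂ, PauliX * σ = a • (σ * PauliX) ∧ PauliZ * σ = b • (σ * PauliZ) ∧
        a * a = 1 ∧ b * b = 1 ∧ (1 + a) * (1 + b) = 0 := by
    rcases hσ with rfl | rfl | rfl
    · refine ⟨1, -1, by simp, ?_, by norm_num, by norm_num, by norm_num⟩
      ext i j
      fin_cases i <;> fin_cases j <;> simp [PauliX, PauliZ, mul_apply]
    · refine ⟨-1, -1, ?_, ?_, by norm_num, by norm_num, by norm_num⟩ <;>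
      · ext i j
        fin_cases i <;> fin_cases j <;> simp [PauliX, PauliY, PauliZ, mul_apply]
    · refine ⟨-1, 1, ?_, by simp, by norm_num, by norm_num, by norm_num⟩
      ext i j
      fin_cases i <;> fin_cases j <;> simp [PauliX, PauliZ, mul_apply]
  have pair {τ σ : Matrix (Fin 2) (Fin 2) ℂ} {c : ℂ} (h : τ * σ = c • (σ * τ))
      (hc : c * c = 1) (u v : V) :
      piKronecker (fun _ : V => τ) * (onQubit σ u * onQubit σ v) =
        (1 : ℂ) • (onQubit σ u * onQubit σ v * piKronecker (fun _ : V => τ)) := by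
    rw [← Matrix.mul_assoc, piKronecker_const_mul_onQubit h, smul_mul_assoc, Matrix.mul_assoc,
      piKronecker_const_mul_onQubit h, mul_smul_comm, smul_smul, hc, Matrix.mul_assoc]
  refine ⟨conjAverage (piKronecker fun _ => PauliZ) (conjAverage (piKronecker fun _ => PauliX) ρ),
    posSemidef_conjAverage _ (posSemidef_conjAverage _ hρ), ?_, fun σ hσ => ?_⟩
  · have h (U : Matrix (V → Fin 2) (V → Fin 2) ℂ) (hU : Uᴴ * U = 1) (ρ) :
        (conjAverage U ρ).trace = ρ.trace := by
      simpa using trace_mul_conjAverage (A := 1) (c := 1) hU (by simp) (by simp) ρ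
    rw [h _ hZ, h _ hX, htr]
  · obtain ⟨a, b, hXσ, hZσ, ha, hb, hab⟩ := signs σ hσ
    refine ⟨fun u => ?_, fun u v => ?_⟩
    · rw [trace_mul_conjAverage hZ (piKronecker_const_mul_onQubit hZσ u) hb,
        trace_mul_conjAverage hX (piKronecker_const_mul_onQubit hXσ u) ha]
      linear_combination (onQubit σ u * ρ).trace / 4 * hab
    · rw [trace_mul_conjAverage hZ (pair hZσ hb u v) (one_mul 1),
        trace_mul_conjAverage hX (pair hXσ ha u v) (one_mul 1)]
      ring

theorem trace_qmcTerm_mul (u v : V) (ρ : Matrix (V → Fin 2) (V → Fin 2) ℂ) :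
    (qmcTerm u v * ρ).trace = 1 / 4 * (ρ.trace
      - (onQubit PauliX u * onQubit PauliX v * ρ).trace
      - (onQubit PauliY u * onQubit PauliY v * ρ).trace
      - (onQubit PauliZ u * onQubit PauliZ v * ρ).trace) := by
  simp [qmcTerm, Matrix.sub_mul, trace_sub]

end Twirl

section Blocks

variable {V κ : Type*} [Fintype V] [DecidableEq V] [Fintype κ] [DecidableEq κ] (block : V → κ)

/-- Assignments on `V` are families of assignments on the blocks. -/
def blockEquiv : (V → Fin 2) ≃ (∀ i, {v : V // block v = i} → Fin 2) where
  toFun s i x := s x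
  invFun s v := s (block v) ⟨v, rfl⟩
  left_inv _ := rfl
  right_inv s := by
    funext i ⟨v, hv⟩
    subst hv
    rfl

theorem onQubit_eq_submatrix (σ : Matrix (Fin 2) (Fin 2) ℂ) {i : κ}
    (x : {v : V // block v = i}) :
    onQubit σ (x : V) =
      (piKronecker (Pi.mulSingle i (onQubit σ x))).submatrix (blockEquiv block)
        (blockEquiv block) := by
  ext s t
  rw [submatrix_apply, piKronecker_mulSingle_apply]
  simp only [onQubit, of_apply, ← ite_and]
  refine if_congr ⟨fun h => ⟨fun j hj => ?_, fun y hy => ?_⟩, fun ⟨h, h'⟩ v hv => ?_⟩ rfl rfl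
  · funext y
    exact h y fun hyx => hj (by rw [← y.2, hyx, x.2])
  · exact h y fun hyx => hy (Subtype.ext hyx)
  · by_cases hvi : block v = i
    · exact h' ⟨v, hvi⟩ fun hvx => hv (congrArg Subtype.val hvx)
    · exact congrFun (h (block v) hvi) ⟨v, rfl⟩

end Blocks

/-- combining assignments on disjoint subgraphs: given a partition of
the vertices into blocks `H_i = block⁻¹(i)` and a density matrix `ρ_i` on each
`(ℂ²)^{⊗H_i}`, there is a density matrix `ρ'` on `(ℂ²)^{⊗V}` that earns the same energy
`tr(Q_{uv} ρ_i)` on every edge inside a block and energy exactly `1/4` on every edge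
between two distinct blocks. -/
theorem stmt_17 {V : Type*} [Fintype V] [DecidableEq V]
    (G : SimpleGraph V) [DecidableRel G.Adj]
    (K : ℕ) (block : V → Fin K)
    (ρ : (i : Fin K) →
      Matrix ({v : V // block v = i} → Fin 2) ({v : V // block v = i} → Fin 2) ℂ)
    (hpsd : ∀ i, (ρ i).PosSemidef) (htr : ∀ i, (ρ i).trace = 1) :
    ∃ ρ' : Matrix (V → Fin 2) (V → Fin 2) ℂ, ρ'.PosSemidef ∧ ρ'.trace = 1 ∧
      (∀ u v (huv : G.Adj u v) (h : block u = block v),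
        (qmcTerm u v * ρ').trace
          = (qmcTerm (⟨u, rfl⟩ : {x : V // block x = block u}) ⟨v, h.symm⟩
              * ρ (block u)).trace) ∧
      (∀ u v, G.Adj u v → block u ≠ block v → (qmcTerm u v * ρ').trace = 1 / 4) := by
  choose τ hτ hτtr hτσ using fun i => exists_pauli_twirl (hpsd i) (htr i)
  have htrace (A : Matrix (∀ i, {v : V // block v = i} → Fin 2) _ ℂ) :
      (A.submatrix (blockEquiv block) (blockEquiv block)).trace = A.trace :=
    (blockEquiv block).sum_comp fun s => A s s
  have hτ1 : ((piKronecker τ).submatrix (blockEquiv block) (blockEquiv block)).trace = 1 := by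
    rw [htrace, trace_piKronecker]
    simp [hτtr]
  refine ⟨(piKronecker τ).submatrix (blockEquiv block) (blockEquiv block),
    (posSemidef_piKronecker hτ).submatrix _, hτ1, fun u v _ h => ?_, fun u v _ h => ?_⟩
  · have corr (σ) (hσ : σ = PauliX ∨ σ = PauliY ∨ σ = PauliZ) :
        (onQubit σ u * onQubit σ v *
          (piKronecker τ).submatrix (blockEquiv block) (blockEquiv block)).trace =
        (onQubit σ (⟨u, rfl⟩ : {x : V // block x = block u}) *
          onQubit σ (⟨v, h.symm⟩ : {x : V // block x = block u}) *
          ρ (block u)).trace := by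
      rw [onQubit_eq_submatrix block σ (⟨u, rfl⟩ : {x : V // block x = block u}),
        onQubit_eq_submatrix block σ (⟨v, h.symm⟩ : {x : V // block x = block u}),
        submatrix_mul_equiv, submatrix_mul_equiv, htrace, piKronecker_mulSingle_mul,
        trace_piKronecker_mulSingle_mul hτtr, (hτσ _ σ hσ).2]
    rw [trace_qmcTerm_mul, trace_qmcTerm_mul, hτ1, htr, corr _ (by simp), corr _ (by simp),
      corr _ (by simp)]
  · have corr (σ) (hσ : σ = PauliX ∨ σ = PauliY ∨ σ = PauliZ) :
        (onQubit σ u * onQubit σ v *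
          (piKronecker τ).submatrix (blockEquiv block) (blockEquiv block)).trace = 0 := by
      rw [onQubit_eq_submatrix block σ (⟨u, rfl⟩ : {x : V // block x = block u}),
        onQubit_eq_submatrix block σ (⟨v, rfl⟩ : {x : V // block x = block v}),
        submatrix_mul_equiv, submatrix_mul_equiv, htrace,
        trace_piKronecker_mulSingle_mul_mulSingle_mul h ((hτσ _ σ hσ).1 _)]
    rw [trace_qmcTerm_mul, hτ1, corr _ (by simp), corr _ (by simp), corr _ (by simp)]
    norm_num
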